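/- Let Φ : Matrix X (Fin m) ℝ be a KROPE representation, i.e. Φ * Φᵀ = K₁ + γ • ((P * Φ) * (P * Φ)ᵀ). Write B := Φᵀ * Φ and C := Φᵀ * P * Φ. Then B * B − γ • (C * Cᵀ) is positive semidefinite (indeed it equals Φᵀ * K₁ * Φ, which is positive semidefinite since K₁ is). -/

import Mathlib

open Matrix

/-- The triangular kernel `1 - |a - b| / 2` on `[-1, 1]` is positive semidefinite: its entries are
half the lengths of the intersections of the intervals `[a, a + 2]` and `[b, b + 2]`. -/
theorem posSemidef_one_sub_abs_sub_div_two {X : Type*} [Finite X] (r : X → ℝ)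
    (hr : ∀ x, |r x| ≤ 1) :
    (Matrix.of fun x y => 1 - |r x - r y| / 2).PosSemidef := by
  have hinter : (Matrix.of fun x y => MeasureTheory.volume.real
      (Set.Icc (r x) (r x + 2) ∩ Set.Icc (r y) (r y + 2))).PosSemidef :=
    MeasureTheory.posSemidef_matrix_measure_inter (fun _ => measurableSet_Icc) (fun _ => by simp)
  convert hinter.smul (show (0 : ℝ) ≤ 1 / 2 by norm_num) using 1
  ext x y
  have hx := abs_le.mp (hr x)
  have hy := abs_le.mp (hr y)
  simp only [Matrix.of_apply, Matrix.smul_apply, smul_eq_mul, Set.Icc_inter_Icc,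
    Real.volume_real_Icc]
  rcases le_total (r x) (r y) with h | h
  · rw [abs_of_nonpos (by linarith), sup_eq_right.mpr h, inf_eq_left.mpr (by linarith),
      max_eq_left (by linarith)]
    ring
  · rw [abs_of_nonneg (by linarith), sup_eq_left.mpr h, inf_eq_right.mpr (by linarith),
      max_eq_left (by linarith)]
    ring

/-- **Covariance identity for KROPE representations.**
If `Φ` is a KROPE representation, i.e. `Φ * Φᵀ = K₁ + γ • ((P * Φ) * (P * Φ)ᵀ)`,
then with `B := Φᵀ * Φ` and `C := Φᵀ * P * Φ`, the matrix
`B * B − γ • (C * Cᵀ)` is positive semidefinite. -/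
theorem krope_covariance_posSemidef
    {X : Type*} [Fintype X] [Nonempty X] [DecidableEq X]
    (γ : ℝ) (hγ0 : 0 ≤ γ) (hγ1 : γ < 1)
    (P : Matrix X X ℝ) (hPnn : ∀ x y, 0 ≤ P x y) (hProw : ∀ x, ∑ y, P x y = 1)
    (r : X → ℝ) (hr : ∀ x, |r x| ≤ 1)
    (K₁ : Matrix X X ℝ) (hK₁ : ∀ x y, K₁ x y = 1 - |r x - r y| / 2)
    (m : ℕ) (Φ : Matrix X (Fin m) ℝ)
    (hΦ : Φ * Φᵀ = K₁ + γ • ((P * Φ) * (P * Φ)ᵀ)) :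
    ((Φᵀ * Φ) * (Φᵀ * Φ) - γ • ((Φᵀ * P * Φ) * (Φᵀ * P * Φ)ᵀ)).PosSemidef := by
  have hK : K₁.PosSemidef := by
    convert posSemidef_one_sub_abs_sub_div_two r hr using 1
    ext x y
    exact hK₁ x y
  have hcov : (Φᵀ * Φ) * (Φᵀ * Φ) - γ • ((Φᵀ * P * Φ) * (Φᵀ * P * Φ)ᵀ) = Φᴴ * K₁ * Φ := by
    rw [conjTranspose_eq_transpose_of_trivial, eq_sub_of_add_eq hΦ.symm]
    simp [Matrix.mul_sub, Matrix.sub_mul, Matrix.mul_assoc, Matrix.transpose_mul]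
  rw [hcov]
  exact hK.conjTranspose_mul_mul_same Φ
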